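/- arXiv:0706.2605 — 4 statements merged into one kernel-verified Lean document; each statement's English description precedes it below -/
import Mathlib

section
/- Let f : [0,∞) → [0,∞) be a continuous function with compact support such that f(0) = 0, and for s,t ≥ 0 set d_f(s,t) = f(s) + f(t) − 2·inf_{u ∈ [s∧t, s∨t]} f(u). Then d_f is a pseudometric on [0,∞): d_f(s,s) = 0, d_f(s,t) = d_f(t,s), and d_f(s,t) ≤ d_f(s,r) + d_f(r,t) for all r,s,t ≥ 0. Moreover d_f(s,t) = 0 if and only if f(s) = f(t) = inf_{u ∈ [s∧t, s∨t]} f(u). -/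
open scoped NNReal

noncomputable section

/-- The pseudo-distance `d_f (s,t) = f s + f t - 2 inf_{u ∈ [s ∧ t, s ∨ t]} f u`
associated to a coding function `f : [0,∞) → [0,∞)`. -/
def treeDist (f : ℝ≥0 → ℝ) (s t : ℝ≥0) : ℝ :=
  f s + f t - 2 * sInf (f '' Set.Icc (min s t) (max s t))

/-- The infimum of a nonnegative function over `[s ∧ t, s ∨ t]` is at most each of its values
there. -/
lemma sInf_image_Icc_min_max_le {f : ℝ≥0 → ℝ} (hf : ∀ t, 0 ≤ f t) {s t u : ℝ≥0}
    (hu : u ∈ Set.Icc (min s t) (max s t)) :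
    sInf (f '' Set.Icc (min s t) (max s t)) ≤ f u :=
  csInf_le ⟨0, Set.forall_mem_image.2 fun x _ => hf x⟩ (Set.mem_image_of_mem f hu)

lemma sInf_image_Icc_min_max_add_le {f : ℝ≥0 → ℝ} (hf : ∀ t, 0 ≤ f t) (r s t : ℝ≥0) :
    sInf (f '' Set.Icc (min s r) (max s r)) + sInf (f '' Set.Icc (min r t) (max r t)) ≤
      f r + sInf (f '' Set.Icc (min s t) (max s t)) := by
  have hsr : sInf (f '' Set.Icc (min s r) (max s r)) ≤ f r :=
    sInf_image_Icc_min_max_le hf (by simp)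
  have hrt : sInf (f '' Set.Icc (min r t) (max r t)) ≤ f r :=
    sInf_image_Icc_min_max_le hf (by simp)
  rw [← sub_le_iff_le_add']
  refine le_csInf ((Set.nonempty_Icc.2 min_le_max).image f) (Set.forall_mem_image.2 fun u hu => ?_)
  obtain h | h := Set.uIcc_subset_uIcc_union_uIcc (b := r) hu
  · linarith [sInf_image_Icc_min_max_le hf h]
  · linarith [sInf_image_Icc_min_max_le hf h]

/-- `d_f` is a pseudometric, vanishing exactly when
`f s = f t = inf_{u ∈ [s ∧ t, s ∨ t]} f u`. -/
theorem treeDist_pseudometric (f : ℝ≥0 → ℝ) (hcont : Continuous f)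
    (hsupp : HasCompactSupport f) (hf0 : f 0 = 0) (hfpos : ∀ t, 0 ≤ f t) :
    (∀ s, treeDist f s s = 0) ∧
    (∀ s t, treeDist f s t = treeDist f t s) ∧
    (∀ r s t, treeDist f s t ≤ treeDist f s r + treeDist f r t) ∧
    (∀ s t, treeDist f s t = 0 ↔
      f s = sInf (f '' Set.Icc (min s t) (max s t)) ∧
        f t = sInf (f '' Set.Icc (min s t) (max s t))) := by
  refine ⟨fun s => ?_, fun s t => ?_, fun r s t => ?_, fun s t => ?_⟩
  · simp [treeDist, two_mul]
  · simp [treeDist, min_comm, max_comm, add_comm]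
  · have h := sInf_image_Icc_min_max_add_le hfpos r s t
    unfold treeDist
    linarith
  · have hs : sInf (f '' Set.Icc (min s t) (max s t)) ≤ f s :=
      sInf_image_Icc_min_max_le hfpos (by simp)
    have ht : sInf (f '' Set.Icc (min s t) (max s t)) ≤ f t :=
      sInf_image_Icc_min_max_le hfpos (by simp)
    unfold treeDist
    constructor
    · intro h
      constructor <;> linarith
    · rintro ⟨h₁, h₂⟩
      linarith
end
end

section
/- Let f : [0,∞) → [0,∞) be a continuous function with compact support such that f(0) = 0. Then the quotient metric space T_f = [0,∞)/∼, where s ∼ t if and only if d_f(s,t) = 0, endowed with the metric induced by d_f, is a compact metric space. -/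
open scoped NNReal

noncomputable section

section TreeDist

variable {f : ℝ≥0 → ℝ}

lemma exists_treeDist_eq (hf : Continuous f) (s t : ℝ≥0) :
    ∃ u ∈ Set.uIcc s t, treeDist f s t = f s + f t - 2 * f u := by
  obtain ⟨u, hu, h⟩ := (isCompact_uIcc (a := s) (b := t)).exists_sInf_image_eq
    Set.nonempty_uIcc hf.continuousOn
  exact ⟨u, hu, by rw [← h]; rfl⟩

lemma le_treeDist (hf : Continuous f) {s t u : ℝ≥0} (hu : u ∈ Set.uIcc s t) :
    f s + f t - 2 * f u ≤ treeDist f s t := by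
  have h : sInf (f '' Set.uIcc s t) ≤ f u :=
    csInf_le (isCompact_uIcc.image hf).bddBelow (Set.mem_image_of_mem f hu)
  change _ ≤ f s + f t - 2 * sInf (f '' Set.uIcc s t)
  linarith

lemma treeDist_self (f : ℝ≥0 → ℝ) (s : ℝ≥0) : treeDist f s s = 0 := by
  simp [treeDist]
  ring

lemma treeDist_comm (f : ℝ≥0 → ℝ) (s t : ℝ≥0) : treeDist f s t = treeDist f t s := by
  simp only [treeDist, min_comm s t, max_comm s t, add_comm (f s)]

lemma treeDist_triangle (hf : Continuous f) (s t u : ℝ≥0) :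
    treeDist f s u ≤ treeDist f s t + treeDist f t u := by
  obtain ⟨v, hv, hsu⟩ := exists_treeDist_eq hf s t
  obtain ⟨w, hw, htu⟩ := exists_treeDist_eq hf t u
  obtain ⟨x, hx, h⟩ := exists_treeDist_eq hf s u
  rcases Set.uIcc_subset_uIcc_union_uIcc (b := t) hx with hx | hx
  · have h₁ := le_treeDist hf hx
    have h₂ := le_treeDist hf (Set.left_mem_uIcc (a := t) (b := u))
    linarith
  · have h₁ := le_treeDist hf hx
    have h₂ := le_treeDist hf (Set.right_mem_uIcc (a := s) (b := t))
    linarith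

lemma exists_treeDist_lt (hf : Continuous f) (s : ℝ≥0) {ε : ℝ} (hε : 0 < ε) :
    ∃ δ > 0, ∀ t, dist t s < δ → treeDist f t s < ε := by
  obtain ⟨δ, hδ, h⟩ := Metric.continuous_iff.1 hf s (ε / 4) (by positivity)
  refine ⟨δ, hδ, fun t ht ↦ ?_⟩
  obtain ⟨u, hu, htu⟩ := exists_treeDist_eq hf t s
  have hus : dist u s < δ := by
    have : dist (u : ℝ) s ≤ dist (t : ℝ) s :=
      Real.dist_right_le_of_mem_uIcc (by
        rw [Set.mem_uIcc] at hu ⊢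
        exact_mod_cast hu)
    exact this.trans_lt ht
  have h₁ := abs_lt.1 (h t ht)
  have h₂ := abs_lt.1 (h u hus)
  linarith [h₁.2, h₂.1]

/-- The half-line, as the carrier of the pseudometric `treeDist f`. -/
def TreeDomain (_ : ℝ≥0 → ℝ) : Type := ℝ≥0

/-- The pseudometric `treeDist f` on the half-line. -/
abbrev treePseudoMetricSpace (hf : Continuous f) : PseudoMetricSpace (TreeDomain f) where
  dist s t := treeDist f s t
  dist_self := treeDist_self f
  dist_comm := treeDist_comm f
  dist_triangle := treeDist_triangle hf

end TreeDist

/-- the quotient metric space `T_f = [0,∞)/∼`, where `s ∼ t` iff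
`d_f(s,t) = 0`, endowed with the metric induced by `d_f`, is a compact metric space.
(The quotient metric space is characterized, up to isometry, as a metric space `T`
together with a surjection `p : [0,∞) → T` satisfying `dist (p s) (p t) = d_f(s,t)`.) -/
theorem treeSpace_compact (f : ℝ≥0 → ℝ) (hcont : Continuous f)
    (hsupp : HasCompactSupport f) (hf0 : f 0 = 0) (hfpos : ∀ t, 0 ≤ f t) :
    ∃ (T : Type) (_ : MetricSpace T) (p : ℝ≥0 → T),
      Function.Surjective p ∧ (∀ s t, dist (p s) (p t) = treeDist f s t) ∧
        CompactSpace T := by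
  let := treePseudoMetricSpace hcont
  let p : ℝ≥0 → SeparationQuotient (TreeDomain f) :=
    SeparationQuotient.mk (X := TreeDomain f)
  have hp : Function.Surjective p := SeparationQuotient.surjective_mk (X := TreeDomain f)
  have hdist (s t : ℝ≥0) : dist (p s) (p t) = treeDist f s t :=
    SeparationQuotient.dist_mk (α := TreeDomain f) s t
  refine ⟨SeparationQuotient (TreeDomain f), inferInstance, p, hp, hdist, ?_⟩
  have hpc : Continuous p := by
    refine Metric.continuous_iff.2 fun s ε hε ↦ ?_
    simpa only [hdist] using exists_treeDist_lt hcont s hε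
  refine ⟨((hsupp.isCompact.insert 0).image hpc).of_isClosed_subset isClosed_univ ?_⟩
  rintro x -
  obtain ⟨t, rfl⟩ := hp x
  by_cases ht : t ∈ tsupport f
  · exact ⟨t, Or.inr ht, rfl⟩
  · refine ⟨0, Or.inl rfl, dist_le_zero.1 ?_⟩
    obtain ⟨u, -, hu⟩ := exists_treeDist_eq hcont 0 t
    rw [hdist, hu, hf0, image_eq_zero_of_notMem_tsupport ht]
    linarith [hfpos u]
end
end

section
/- Let x = (x₀, …, x_n) be a downward skip-free chain of length n and let K ≥ 1 be an integer with x_i > −K for all 0 ≤ i < n and x_n = −K. Then for every 0 ≤ k ≤ K (so that t(k) ≤ n), the height process of the cyclically shifted chain θ_{t(k)}(x) is the cyclic shift of the height process of x: H_i^{θ_{t(k)}(x)} = H_{t(k)+i}^x for 0 ≤ i ≤ n − t(k), and H_i^{θ_{t(k)}(x)} = H_{i−(n−t(k))}^x for n − t(k) ≤ i ≤ n. -/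
noncomputable section

/-- `H_m^x = card {i ∈ {0, …, m-1} : x i = inf_{i ≤ j ≤ m} x j}`, the height process
of a downward skip-free chain `x`. -/
def chainHeight (x : ℕ → ℤ) (m : ℕ) : ℕ :=
  ((Finset.range m).filter fun i => ∀ j ∈ Finset.Icc i m, x i ≤ x j).card

/-- The cyclically shifted chain `θ_{tk}(x)` (for a chain of length `n`):
`θ_{tk}(x) i = x (i + tk) + k` for `i ≤ n - tk` and
`θ_{tk}(x) i = x (tk + i - n) + x n + k` for `n - tk ≤ i ≤ n`. -/
def cyclicShift (x : ℕ → ℤ) (n tk k : ℕ) (i : ℕ) : ℤ :=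
  if i ≤ n - tk then x (i + tk) + k else x (tk + i - n) + x n + k

/-- A skip-free chain that starts at `0` stays above `-k` as long as it has not hit `-k`. -/
theorem neg_lt_of_forall_ne {x : ℕ → ℤ} {n k : ℕ} (hx0 : x 0 = 0)
    (hstep : ∀ i < n, -1 ≤ x (i + 1) - x i) {j : ℕ} (hj : j ≤ n)
    (hne : ∀ i ≤ j, x i ≠ -(k : ℤ)) : -(k : ℤ) < x j := by
  induction j with
  | zero =>
    have := hne 0 le_rfl
    omega
  | succ j ih =>
    have h₁ := ih (by omega) fun i hi => hne i (by omega)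
    have h₂ := hstep j (by omega)
    have h₃ := hne (j + 1) le_rfl
    omega

/-- If `y` reaches a strict running minimum at time `a` and then follows a vertical translate
of `x`, then the height process of `y` after time `a` is that of `x`. -/
theorem chainHeight_add {x y : ℕ → ℤ} {a m : ℕ} (c : ℤ)
    (hlt : ∀ j < a, y a < y j) (heq : ∀ j ≤ m, y (a + j) = x j + c) :
    chainHeight y (a + m) = chainHeight x m := by
  unfold chainHeight
  symm
  refine Finset.card_bij (fun j _ => a + j) ?_ (fun _ _ _ _ h => Nat.add_left_cancel h) ?_
  · intro j hj
    simp only [Finset.mem_filter, Finset.mem_range, Finset.mem_Icc] at hj ⊢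
    refine ⟨by omega, fun l hl => ?_⟩
    obtain ⟨l, rfl⟩ := Nat.exists_eq_add_of_le (show a ≤ l by omega)
    rw [heq j (by omega), heq l (by omega)]
    have := hj.2 l (by omega)
    omega
  · intro i hi
    simp only [Finset.mem_filter, Finset.mem_range, Finset.mem_Icc] at hi
    have hai : a ≤ i := by
      by_contra! h
      exact (hlt i h).not_ge (hi.2 a (by omega))
    obtain ⟨j, rfl⟩ := Nat.exists_eq_add_of_le hai
    refine ⟨j, ?_, rfl⟩
    simp only [Finset.mem_filter, Finset.mem_range, Finset.mem_Icc]
    refine ⟨by omega, fun l hl => ?_⟩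
    have := hi.2 (a + l) (by omega)
    rw [heq j (by omega), heq l (by omega)] at this
    omega

/-- for a downward skip-free chain `x` of length `n` first reaching `-K`
at time `n`, and `0 ≤ k ≤ K` with first passage time `t(k) = inf {i : x i = -k}`, the
height process of the cyclically shifted chain `θ_{t(k)}(x)` is the cyclic shift of the
height process of `x`. -/
theorem chainHeight_cyclicShift (x : ℕ → ℤ) (n K : ℕ) (hK : 1 ≤ K)
    (hx0 : x 0 = 0) (hstep : ∀ i < n, -1 ≤ x (i + 1) - x i)
    (hbefore : ∀ i < n, -(K : ℤ) < x i) (hxn : x n = -(K : ℤ))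
    (k : ℕ) (hk : k ≤ K) :
    (∀ i ≤ n - sInf {i : ℕ | x i = -(k : ℤ)},
      chainHeight (cyclicShift x n (sInf {i : ℕ | x i = -(k : ℤ)}) k) i =
        chainHeight x (sInf {i : ℕ | x i = -(k : ℤ)} + i)) ∧
    (∀ i, n - sInf {i : ℕ | x i = -(k : ℤ)} ≤ i → i ≤ n →
      chainHeight (cyclicShift x n (sInf {i : ℕ | x i = -(k : ℤ)}) k) i =
        chainHeight x (i - (n - sInf {i : ℕ | x i = -(k : ℤ)}))) := by
  obtain ⟨i₀, hi₀n, hi₀⟩ : ∃ i ≤ n, x i = -(k : ℤ) := by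
    by_contra! h
    have := neg_lt_of_forall_ne hx0 hstep le_rfl h
    omega
  have ht : x (sInf {i : ℕ | x i = -(k : ℤ)}) = -(k : ℤ) :=
    Nat.sInf_mem (s := {i : ℕ | x i = -(k : ℤ)}) ⟨i₀, hi₀⟩
  have htn : sInf {i : ℕ | x i = -(k : ℤ)} ≤ n :=
    (Nat.sInf_le (s := {i : ℕ | x i = -(k : ℤ)}) hi₀).trans hi₀n
  have hlt : ∀ j < sInf {i : ℕ | x i = -(k : ℤ)}, -(k : ℤ) < x j := fun j hj =>
    neg_lt_of_forall_ne hx0 hstep (by omega) fun i hi =>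
      Nat.notMem_of_lt_sInf (hi.trans_lt hj)
  generalize sInf {i : ℕ | x i = -(k : ℤ)} = t at ht htn hlt
  constructor
  · intro i hi
    refine (chainHeight_add (-(k : ℤ)) (fun j hj => ht ▸ hlt j hj) fun j hj => ?_).symm
    rw [cyclicShift, if_pos (by omega), add_comm j t]
    ring
  · intro i hi hin
    obtain ⟨m, rfl⟩ := Nat.exists_eq_add_of_le hi
    rw [Nat.add_sub_cancel_left]
    refine chainHeight_add (x n + k) (fun j hj => ?_) fun j hj => ?_
    · rw [cyclicShift, cyclicShift, if_pos le_rfl, if_pos hj.le, Nat.sub_add_cancel htn, hxn]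
      have := hbefore (j + t) (by omega)
      omega
    · rcases Nat.eq_zero_or_pos j with rfl | hj₀
      · rw [cyclicShift, add_zero, if_pos le_rfl, Nat.sub_add_cancel htn, hx0, zero_add]
      · rw [cyclicShift, if_neg (by omega), show t + (n - t + j) - n = j by omega, add_assoc]
end
end

section
/- Let (τ_j)_{j≥1} be an infinite sequence of plane trees, and let H and S be respectively the height process and the coding walk of the forest F = (τ_j)_{j≥1}. Then for every n ≥ 0, H_n = card{0 ≤ k ≤ n−1 : S_k = inf_{k≤j≤n} S_j}. -/
noncomputable section

/-- A plane tree: a finite set of finite sequences of positive integers containing the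
root `[]`, closed under taking parents, with children of each vertex indexed `1, …, k`. -/
def IsPlaneTree (τ : Finset (List ℕ)) : Prop :=
  ([] : List ℕ) ∈ τ ∧
    (∀ (u : List ℕ) (j : ℕ), u ++ [j] ∈ τ → u ∈ τ) ∧
    ∀ u ∈ τ, ∃ k : ℕ, ∀ j : ℕ, u ++ [j] ∈ τ ↔ 1 ≤ j ∧ j ≤ k

/-- `k_u(τ)`: the number of children of the vertex `u` in `τ`. -/
def childCount (τ : Finset (List ℕ)) (u : List ℕ) : ℕ :=
  (τ.filter fun v => v ≠ [] ∧ v.dropLast = u).card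

/-- `u(n)`: the `n`-th vertex of `τ` in lexicographical order. -/
def vertex (τ : Finset (List ℕ)) (n : ℕ) : List ℕ :=
  (τ.sort (· ≤ ·)).getD n ([] : List ℕ)

/-- The height function of a plane tree: `H n τ = |u(n)|`. -/
def treeHeight (τ : Finset (List ℕ)) (n : ℕ) : ℕ := (vertex τ n).length

/-- The coding walk of a plane tree: `S 0 = 0`, `S (n+1) - S n = k_{u(n)}(τ) - 1`. -/
def treeWalk (τ : Finset (List ℕ)) (n : ℕ) : ℤ :=
  ∑ i ∈ Finset.range n, ((childCount τ (vertex τ i) : ℤ) - 1)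

/-- `ζ(τ₀) + … + ζ(τ_{j-1})`: the total size of the first `j` trees of the forest `F`. -/
def cumSize (F : ℕ → Finset (List ℕ)) (j : ℕ) : ℕ :=
  ∑ i ∈ Finset.range j, (F i).card

/-- The index of the tree of the forest `F` being visited at time `n`. -/
def treeIndex (F : ℕ → Finset (List ℕ)) (n : ℕ) : ℕ :=
  sSup {j : ℕ | cumSize F j ≤ n}

/-- The height process of an infinite forest: the concatenation of the height
functions of its trees. -/
def forestHeight (F : ℕ → Finset (List ℕ)) (n : ℕ) : ℕ :=
  treeHeight (F (treeIndex F n)) (n - cumSize F (treeIndex F n))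

/-- The coding walk of an infinite forest: the concatenation of the coding walks of its
trees, the walk of the `(j+1)`-st tree being shifted by `-j`. -/
def forestWalk (F : ℕ → Finset (List ℕ)) (n : ℕ) : ℤ :=
  treeWalk (F (treeIndex F n)) (n - cumSize F (treeIndex F n)) - treeIndex F n

theorem List.append_lt_of_lt_of_not_isPrefix {x y : List ℕ} (hxy : x < y) (h : ¬ x <+: y)
    (t : List ℕ) : x ++ t < y := by
  induction x generalizing y with
  | nil => exact absurd List.nil_prefix h
  | cons a x ih =>
    cases y with
    | nil => simp at hxy
    | cons b y =>
      rw [List.cons_append, List.cons_lt_cons_iff]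
      rcases List.cons_lt_cons_iff.1 hxy with hab | ⟨rfl, hlt⟩
      · exact Or.inl hab
      · exact Or.inr ⟨rfl, ih hlt fun hp => h (List.cons_prefix_cons.2 ⟨rfl, hp⟩)⟩

theorem List.IsPrefix.lt_of_lt_of_not_isPrefix {x y z : List ℕ} (hxz : x <+: z) (hxy : x < y)
    (h : ¬ x <+: y) : z < y := by
  obtain ⟨t, rfl⟩ := hxz
  exact List.append_lt_of_lt_of_not_isPrefix hxy h t

theorem List.IsPrefix.lex_le {x y : List ℕ} (h : x <+: y) : x ≤ y := by
  obtain ⟨t, rfl⟩ := h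
  induction x with
  | nil => exact not_lt.1 (List.not_lt_nil _)
  | cons a x ih => exact List.cons_le_cons _ ih

theorem List.IsPrefix.of_le_of_le {x y z : List ℕ} (hxy : x <+: y) (hxz : x ≤ z) (hzy : z ≤ y) :
    x <+: z := by
  by_contra h
  rcases eq_or_lt_of_le hxz with rfl | hlt
  · exact h (List.prefix_refl _)
  · exact absurd (hxy.lt_of_lt_of_not_isPrefix hlt h) (not_lt.2 hzy)

theorem List.dropLast_lt_self {v : List ℕ} (hv : v ≠ []) : v.dropLast < v := by
  refine lt_of_le_of_ne (List.dropLast_prefix v).lex_le fun h => ?_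
  have := congrArg List.length h
  have := List.length_pos_of_ne_nil hv
  simp only [List.length_dropLast] at *
  omega

theorem List.IsPrefix.dropLast_of_ne {x v : List ℕ} (h : x <+: v) (hne : x ≠ v) :
    x <+: v.dropLast := by
  refine List.prefix_of_prefix_length_le h (List.dropLast_prefix v) ?_
  have := h.length_le
  have : x.length ≠ v.length := fun hl => hne (h.eq_of_length hl)
  simp only [List.length_dropLast]
  omega

theorem vertex_eq_orderEmbOfFin (τ : Finset (List ℕ)) {n : ℕ} (hn : n < τ.card) :
    vertex τ n = τ.orderEmbOfFin rfl ⟨n, hn⟩ := by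
  rw [Finset.orderEmbOfFin_apply, vertex, List.getD_eq_getElem]
  rfl

theorem vertex_mem {τ : Finset (List ℕ)} {n : ℕ} (hn : n < τ.card) : vertex τ n ∈ τ := by
  rw [vertex_eq_orderEmbOfFin τ hn]
  exact Finset.orderEmbOfFin_mem _ _ _

theorem vertex_lt_vertex {τ : Finset (List ℕ)} {m n : ℕ} (hm : m < τ.card) (hn : n < τ.card) :
    vertex τ m < vertex τ n ↔ m < n := by
  simp [vertex_eq_orderEmbOfFin τ hm, vertex_eq_orderEmbOfFin τ hn]

theorem vertex_le_vertex {τ : Finset (List ℕ)} {m n : ℕ} (hm : m < τ.card) (hn : n < τ.card) :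
    vertex τ m ≤ vertex τ n ↔ m ≤ n := by
  simp [vertex_eq_orderEmbOfFin τ hm, vertex_eq_orderEmbOfFin τ hn]

theorem exists_vertex_eq {τ : Finset (List ℕ)} {v : List ℕ} (hv : v ∈ τ) :
    ∃ n < τ.card, vertex τ n = v := by
  have : v ∈ Set.range (τ.orderEmbOfFin rfl) := by simpa using hv
  obtain ⟨i, rfl⟩ := this
  exact ⟨i, i.2, vertex_eq_orderEmbOfFin τ i.2⟩

theorem vertex_injOn (τ : Finset (List ℕ)) : Set.InjOn (vertex τ) (Set.Iio τ.card) := by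
  intro i hi j hj h
  exact le_antisymm ((vertex_le_vertex hi hj).1 h.le) ((vertex_le_vertex hj hi).1 h.ge)

theorem image_vertex_range {τ : Finset (List ℕ)} {n : ℕ} (hn : n < τ.card) :
    (Finset.range n).image (vertex τ) = τ.filter (· < vertex τ n) := by
  ext v
  simp only [Finset.mem_image, Finset.mem_range, Finset.mem_filter]
  constructor
  · rintro ⟨i, hi, rfl⟩
    exact ⟨vertex_mem (hi.trans hn), (vertex_lt_vertex (hi.trans hn) hn).2 hi⟩
  · rintro ⟨hv, hlt⟩
    obtain ⟨i, hi, rfl⟩ := exists_vertex_eq hv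
    exact ⟨i, (vertex_lt_vertex hi hn).1 hlt, rfl⟩

theorem injOn_vertex_range {τ : Finset (List ℕ)} {n : ℕ} (hn : n < τ.card) :
    Set.InjOn (vertex τ) (Finset.range n) :=
  (vertex_injOn τ).mono fun _ hi => (Finset.mem_range.1 hi).trans hn

theorem card_filter_lt_vertex {τ : Finset (List ℕ)} {n : ℕ} (hn : n < τ.card) :
    (τ.filter (· < vertex τ n)).card = n := by
  rw [← image_vertex_range hn, Finset.card_image_of_injOn (injOn_vertex_range hn),
    Finset.card_range]

theorem IsPlaneTree.mem_of_isPrefix {τ : Finset (List ℕ)} (hτ : IsPlaneTree τ) {x y : List ℕ}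
    (h : x <+: y) (hy : y ∈ τ) : x ∈ τ := by
  obtain ⟨t, rfl⟩ := h
  induction t using List.reverseRecOn with
  | nil => simpa using hy
  | append_singleton t a ih =>
    exact ih (hτ.2.1 _ a (by simpa using hy))

theorem IsPlaneTree.card_pos {τ : Finset (List ℕ)} (hτ : IsPlaneTree τ) : 0 < τ.card :=
  Finset.card_pos.2 ⟨[], hτ.1⟩

/-- The vertices after `u` whose parent is strictly before `u`. -/
def pendingVertices (τ : Finset (List ℕ)) (u : List ℕ) : Finset (List ℕ) :=
  τ.filter fun v => u < v ∧ v.dropLast < u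

theorem mem_pendingVertices {τ : Finset (List ℕ)} {u v : List ℕ} :
    v ∈ pendingVertices τ u ↔ v ∈ τ ∧ u < v ∧ v.dropLast < u := by
  simp [pendingVertices]

theorem ne_nil_of_lt {u v : List ℕ} (h : u < v) : v ≠ [] := by
  rintro rfl
  exact absurd h (List.not_lt_nil u)

theorem IsPlaneTree.treeWalk_eq_card {τ : Finset (List ℕ)} (hτ : IsPlaneTree τ) {n : ℕ}
    (hn : n < τ.card) : treeWalk τ n = (pendingVertices τ (vertex τ n)).card := by
  set u := vertex τ n with hu
  have hchild : ∑ i ∈ Finset.range n, childCount τ (vertex τ i) =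
      (τ.filter fun v => v ≠ [] ∧ v.dropLast < u).card := by
    rw [← Finset.sum_image (f := childCount τ) (injOn_vertex_range hn), image_vertex_range hn,
      Finset.card_eq_sum_card_fiberwise (f := List.dropLast) (t := τ.filter (· < u))]
    · refine Finset.sum_congr rfl fun x hx => ?_
      rw [childCount, Finset.filter_filter]
      congr 1
      ext v
      simp only [Finset.mem_filter] at hx ⊢
      constructor
      · rintro ⟨h1, h2, rfl⟩
        exact ⟨h1, ⟨h2, hx.2⟩, rfl⟩
      · rintro ⟨h1, ⟨h2, _⟩, h3⟩
        exact ⟨h1, h2, h3⟩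
    · intro v hv
      simp only [Finset.coe_filter, Set.mem_ofPred_eq] at hv ⊢
      exact ⟨hτ.mem_of_isPrefix (List.dropLast_prefix v) hv.1, hv.2.2⟩
  have hsplit : (τ.filter fun v => v ≠ [] ∧ v.dropLast < u) =
      pendingVertices τ u ∪ τ.filter fun v => v ≠ [] ∧ v ≤ u := by
    ext v
    simp only [Finset.mem_union, mem_pendingVertices, Finset.mem_filter]
    constructor
    · rintro ⟨h1, h2, h3⟩
      rcases lt_or_ge u v with h | h
      · exact Or.inl ⟨h1, h, h3⟩
      · exact Or.inr ⟨h1, h2, h⟩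
    · rintro (⟨h1, h2, h3⟩ | ⟨h1, h2, h3⟩)
      · exact ⟨h1, ne_nil_of_lt h2, h3⟩
      · exact ⟨h1, h2, (List.dropLast_lt_self h2).trans_le h3⟩
  have hdisj : Disjoint (pendingVertices τ u) (τ.filter fun v => v ≠ [] ∧ v ≤ u) := by
    rw [Finset.disjoint_left]
    intro v h1 h2
    exact absurd (mem_pendingVertices.1 h1).2.1 (not_lt.2 (Finset.mem_filter.1 h2).2.2)
  have hinsert : insert [] (τ.filter fun v => v ≠ [] ∧ v ≤ u) =
      insert u (τ.filter (· < u)) := by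
    ext v
    simp only [Finset.mem_insert, Finset.mem_filter]
    constructor
    · rintro (rfl | ⟨h1, _, h3⟩)
      · rcases eq_or_lt_of_le (List.nil_prefix (l := u)).lex_le with h | h
        · exact Or.inl h
        · exact Or.inr ⟨hτ.1, h⟩
      · rcases eq_or_lt_of_le h3 with h | h
        · exact Or.inl h
        · exact Or.inr ⟨h1, h⟩
    · intro h
      by_cases hv : v = []
      · exact Or.inl hv
      · rcases h with rfl | ⟨h1, h2⟩
        · exact Or.inr ⟨vertex_mem hn, hv, le_rfl⟩
        · exact Or.inr ⟨h1, hv, h2.le⟩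
  have hcard : (τ.filter fun v => v ≠ [] ∧ v ≤ u).card = n := by
    have h := congrArg Finset.card hinsert
    rwa [Finset.card_insert_of_notMem (by simp), Finset.card_insert_of_notMem (by simp),
      card_filter_lt_vertex hn, Nat.add_right_cancel_iff] at h
  rw [hsplit, Finset.card_union_of_disjoint hdisj, hcard] at hchild
  rw [treeWalk, Finset.sum_sub_distrib, ← Nat.cast_sum, hchild]
  simp

theorem pendingVertices_subset_of_isPrefix {τ : Finset (List ℕ)} {x y : List ℕ} (h : x <+: y) :
    pendingVertices τ x ⊆ pendingVertices τ y := by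
  intro v hv
  obtain ⟨h1, h2, h3⟩ := mem_pendingVertices.1 hv
  have hnot : ¬ x <+: v := fun hp =>
    absurd h3 (not_lt.2 (hp.dropLast_of_ne h2.ne).lex_le)
  exact mem_pendingVertices.2
    ⟨h1, h.lt_of_lt_of_not_isPrefix h2 hnot, h3.trans_le h.lex_le⟩

theorem IsPlaneTree.exists_pendingVertices_ssubset {τ : Finset (List ℕ)} (hτ : IsPlaneTree τ)
    {x w : List ℕ} (hw : w ∈ τ) (hxw : x < w) (hpre : ¬ x <+: w) :
    ∃ y ∈ τ, x < y ∧ y ≤ w ∧ pendingVertices τ y ⊂ pendingVertices τ x := by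
  obtain ⟨y, hyw, hy⟩ := Finset.exists_le_minimal (τ.filter fun y => x < y ∧ ¬ x <+: y)
    (Finset.mem_filter.2 ⟨hw, hxw, hpre⟩)
  obtain ⟨hyτ, hxy, hypre⟩ := Finset.mem_filter.1 hy.prop
  have hmin : ∀ v ∈ τ, x ≤ v → v < y → x <+: v := by
    intro v hv hxv hvy
    by_contra hp
    have hlt : x < v := lt_of_le_of_ne hxv (by rintro rfl; exact hp (List.prefix_refl _))
    exact hy.not_lt (Finset.mem_filter.2 ⟨hv, hlt, hp⟩) hvy
  refine ⟨y, hyτ, hxy, hyw, Finset.ssubset_iff_of_subset ?_ |>.2 ⟨y, ?_, ?_⟩⟩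
  · intro v hv
    obtain ⟨h1, h2, h3⟩ := mem_pendingVertices.1 hv
    refine mem_pendingVertices.2 ⟨h1, hxy.trans h2, ?_⟩
    by_contra hge
    have hp := hmin _ (hτ.mem_of_isPrefix (List.dropLast_prefix v) h1) (not_lt.1 hge) h3
    exact absurd ((hp.trans (List.dropLast_prefix v)).lt_of_lt_of_not_isPrefix hxy hypre) h2.asymm
  · refine mem_pendingVertices.2 ⟨hyτ, hxy, ?_⟩
    by_contra hge
    exact hypre ((hmin _ (hτ.mem_of_isPrefix (List.dropLast_prefix y) hyτ) (not_lt.1 hge)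
      (List.dropLast_lt_self (ne_nil_of_lt hxy))).trans (List.dropLast_prefix y))
  · intro h
    exact lt_irrefl _ (mem_pendingVertices.1 h).2.1

/-- Time `k` is a weak record of the walk seen backwards from time `n` exactly when the `k`-th
vertex is an ancestor of the `n`-th. -/
theorem IsPlaneTree.forall_treeWalk_le_iff {τ : Finset (List ℕ)} (hτ : IsPlaneTree τ) {k n : ℕ}
    (hk : k < n) (hn : n < τ.card) :
    (∀ j ∈ Finset.Icc k n, treeWalk τ k ≤ treeWalk τ j) ↔ vertex τ k <+: vertex τ n := by
  have hkc := hk.trans hn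
  constructor
  · intro h
    by_contra hp
    obtain ⟨y, hy, hxy, hyw, hss⟩ := hτ.exists_pendingVertices_ssubset (vertex_mem hn)
      ((vertex_lt_vertex hkc hn).2 hk) hp
    obtain ⟨j, hj, rfl⟩ := exists_vertex_eq hy
    have := h j (Finset.mem_Icc.2
      ⟨((vertex_lt_vertex hkc hj).1 hxy).le, (vertex_le_vertex hj hn).1 hyw⟩)
    rw [hτ.treeWalk_eq_card hkc, hτ.treeWalk_eq_card hj, Nat.cast_le] at this
    exact absurd (Finset.card_lt_card hss) (not_lt.2 this)
  · intro h j hj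
    obtain ⟨hkj, hjn⟩ := Finset.mem_Icc.1 hj
    have hjc := hjn.trans_lt hn
    rw [hτ.treeWalk_eq_card hkc, hτ.treeWalk_eq_card hjc, Nat.cast_le]
    exact Finset.card_le_card (pendingVertices_subset_of_isPrefix
      (h.of_le_of_le ((vertex_le_vertex hkc hjc).2 hkj) ((vertex_le_vertex hjc hn).2 hjn)))

theorem IsPlaneTree.treeHeight_eq_card {τ : Finset (List ℕ)} (hτ : IsPlaneTree τ) {n : ℕ}
    (hn : n < τ.card) :
    treeHeight τ n =
      ((Finset.range n).filter fun k =>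
        ∀ j ∈ Finset.Icc k n, treeWalk τ k ≤ treeWalk τ j).card := by
  rw [Finset.filter_congr fun k hk => hτ.forall_treeWalk_le_iff (Finset.mem_range.1 hk) hn,
    ← Finset.card_image_of_injOn ((injOn_vertex_range hn).mono (Finset.filter_subset _ _)),
    treeHeight]
  set w := vertex τ n with hw
  have : ((Finset.range n).filter fun k => vertex τ k <+: w).image (vertex τ) =
      (Finset.range w.length).image fun i => w.take i := by
    ext v
    simp only [Finset.mem_image, Finset.mem_filter, Finset.mem_range]
    constructor
    · rintro ⟨k, ⟨hk, hp⟩, rfl⟩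
      have hne : vertex τ k ≠ w := ((vertex_lt_vertex (hk.trans hn) hn).2 hk).ne
      exact ⟨(vertex τ k).length,
        lt_of_le_of_ne hp.length_le fun h => hne (hp.eq_of_length h),
        (List.prefix_iff_eq_take.1 hp).symm⟩
    · rintro ⟨i, hi, rfl⟩
      have hp := List.take_prefix i w
      obtain ⟨k, hk, hkv⟩ := exists_vertex_eq (hτ.mem_of_isPrefix hp (vertex_mem hn))
      refine ⟨k, ⟨(vertex_lt_vertex hk hn).1 ?_, hkv ▸ hp⟩, hkv⟩
      refine lt_of_le_of_ne (hkv ▸ hp.lex_le) fun h => ?_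
      have := congrArg List.length (hkv.symm.trans h)
      rw [← hw, List.length_take] at this
      omega
  rw [this, Finset.card_image_of_injOn, Finset.card_range]
  intro i hi j hj h
  have hi' := Finset.mem_range.1 hi
  have hj' := Finset.mem_range.1 hj
  have := congrArg List.length h
  simp only [List.length_take] at this
  omega

theorem strictMono_cumSize {F : ℕ → Finset (List ℕ)} (hF : ∀ i, IsPlaneTree (F i)) :
    StrictMono (cumSize F) :=
  strictMono_nat_of_lt_succ fun j => by
    rw [cumSize, cumSize, Finset.sum_range_succ]
    exact Nat.lt_add_of_pos_right (hF j).card_pos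

theorem bddAbove_cumSize_le {F : ℕ → Finset (List ℕ)} (hF : ∀ i, IsPlaneTree (F i)) (n : ℕ) :
    BddAbove {j : ℕ | cumSize F j ≤ n} :=
  ⟨n, fun _ hj => ((strictMono_cumSize hF).id_le _).trans hj⟩

theorem cumSize_treeIndex_le {F : ℕ → Finset (List ℕ)} (hF : ∀ i, IsPlaneTree (F i)) (n : ℕ) :
    cumSize F (treeIndex F n) ≤ n :=
  Nat.sSup_mem (s := {j : ℕ | cumSize F j ≤ n}) ⟨0, by simp [cumSize]⟩ (bddAbove_cumSize_le hF n)

theorem le_treeIndex_iff {F : ℕ → Finset (List ℕ)} (hF : ∀ i, IsPlaneTree (F i)) {j n : ℕ} :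
    j ≤ treeIndex F n ↔ cumSize F j ≤ n :=
  ⟨fun h => ((strictMono_cumSize hF).monotone h).trans (cumSize_treeIndex_le hF n),
    fun h => le_csSup (bddAbove_cumSize_le hF n) h⟩

theorem treeIndex_mono {F : ℕ → Finset (List ℕ)} (hF : ∀ i, IsPlaneTree (F i)) :
    Monotone (treeIndex F) :=
  fun _ _ h => (le_treeIndex_iff hF).2 ((cumSize_treeIndex_le hF _).trans h)

theorem sub_cumSize_treeIndex_lt {F : ℕ → Finset (List ℕ)} (hF : ∀ i, IsPlaneTree (F i)) (n : ℕ) :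
    n - cumSize F (treeIndex F n) < (F (treeIndex F n)).card := by
  have h : ¬ cumSize F (treeIndex F n + 1) ≤ n := fun h =>
    absurd ((le_treeIndex_iff hF).2 h) (by omega)
  rw [cumSize, Finset.sum_range_succ, ← cumSize] at h
  have := cumSize_treeIndex_le hF n
  omega

theorem neg_treeIndex_le_forestWalk {F : ℕ → Finset (List ℕ)} (hF : ∀ i, IsPlaneTree (F i))
    (n : ℕ) : -(treeIndex F n : ℤ) ≤ forestWalk F n := by
  rw [forestWalk, (hF _).treeWalk_eq_card (sub_cumSize_treeIndex_lt hF n)]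
  omega

theorem treeIndex_eq_of_mem_Icc {F : ℕ → Finset (List ℕ)} (hF : ∀ i, IsPlaneTree (F i)) {m n : ℕ}
    (hm : cumSize F (treeIndex F n) ≤ m) (hmn : m ≤ n) : treeIndex F m = treeIndex F n :=
  le_antisymm (treeIndex_mono hF hmn) ((le_treeIndex_iff hF).2 hm)

theorem forestWalk_eq_of_mem_Icc {F : ℕ → Finset (List ℕ)} (hF : ∀ i, IsPlaneTree (F i)) {m n : ℕ}
    (hm : cumSize F (treeIndex F n) ≤ m) (hmn : m ≤ n) :
    forestWalk F m =
      treeWalk (F (treeIndex F n)) (m - cumSize F (treeIndex F n)) - treeIndex F n := by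
  rw [forestWalk, treeIndex_eq_of_mem_Icc hF hm hmn]

/-- for an infinite forest `F = (τ_j)`, the height process `H` and the
coding walk `S` of `F` satisfy, for every `n ≥ 0`,
`H n = card {k ∈ {0, …, n-1} : S k = inf_{k ≤ j ≤ n} S j}`. -/
theorem forestHeight_eq_walk_functional (F : ℕ → Finset (List ℕ))
    (hF : ∀ i, IsPlaneTree (F i)) (n : ℕ) :
    forestHeight F n =
      ((Finset.range n).filter fun k =>
        ∀ j ∈ Finset.Icc k n, forestWalk F k ≤ forestWalk F j).card := by
  have hcn := cumSize_treeIndex_le hF n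
  rw [forestHeight, (hF _).treeHeight_eq_card (sub_cumSize_treeIndex_lt hF n),
    ← Finset.card_map (addRightEmbedding (cumSize F (treeIndex F n)))]
  congr 1
  ext k
  simp only [Finset.mem_map, Finset.mem_filter, Finset.mem_range, Finset.mem_Icc,
    addRightEmbedding_apply]
  constructor
  · rintro ⟨i, ⟨hi, h⟩, rfl⟩
    refine ⟨by omega, fun j hj => ?_⟩
    rw [forestWalk_eq_of_mem_Icc hF (Nat.le_add_left _ _) (by omega : _ ≤ n),
      forestWalk_eq_of_mem_Icc hF (by omega) hj.2, Nat.add_sub_cancel]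
    exact sub_le_sub_right (h _ (by omega)) _
  · rintro ⟨hk, h⟩
    have hck : cumSize F (treeIndex F n) ≤ k := by
      by_contra hlt
      have hidx : treeIndex F k < treeIndex F n :=
        not_le.1 fun hle => hlt ((le_treeIndex_iff hF).1 hle)
      have h1 := h (cumSize F (treeIndex F n)) (by omega)
      rw [forestWalk_eq_of_mem_Icc hF le_rfl hcn, Nat.sub_self] at h1
      have h2 := neg_treeIndex_le_forestWalk hF k
      simp only [treeWalk, Finset.range_zero, Finset.sum_empty] at h1
      omega
    refine ⟨k - cumSize F (treeIndex F n), ⟨by omega, fun j hj => ?_⟩, by omega⟩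
    have h1 := h (j + cumSize F (treeIndex F n)) (by omega)
    rw [forestWalk_eq_of_mem_Icc hF hck hk.le,
      forestWalk_eq_of_mem_Icc hF (Nat.le_add_left _ _) (by omega : _ ≤ n),
      Nat.add_sub_cancel] at h1
    linarith
end
end
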